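/- arXiv:2308.16058 — 2 statements merged into one kernel-verified Lean document; each statement's English description precedes it below -/
import Mathlib

section
/- Explosive variance in the Harvey–Fernandes model (deterministic core of Lemma 3): let q ∈ (0,1), M > 0, and let (λ_t)_{t≥1} be a real sequence with 0 < λ_t ≤ M for all t. Let β_1 > 0 and β_{t+1} = q·β_t + λ_{t+1} for t ≥ 1, and let (v_t)_{t≥1} be a real sequence satisfying v_{t+1} = v_t + (1/q − 1)·(1/β_t) for all t ≥ 1. Then v_t → ∞ as t → ∞. -/
/-- A real sequence whose increments are eventually bounded below by a positive constant
tends to infinity. -/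
theorem tendsto_atTop_of_add_const_le {u : ℕ → ℝ} {c : ℝ} {n₀ : ℕ} (hc : 0 < c)
    (hu : ∀ n ≥ n₀, u n + c ≤ u (n + 1)) : Filter.Tendsto u Filter.atTop Filter.atTop := by
  have key : ∀ k : ℕ, u n₀ + k * c ≤ u (k + n₀) := by
    intro k
    induction k with
    | zero => simp
    | succ k ih =>
      have h := hu (k + n₀) (Nat.le_add_left _ _)
      rw [Nat.add_right_comm k 1 n₀]
      push_cast
      linarith
  rw [← Filter.tendsto_add_atTop_iff_nat n₀]
  exact Filter.tendsto_atTop_mono key (Filter.tendsto_atTop_add_const_left _ _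
    (tendsto_natCast_atTop_atTop.atTop_mul_const hc))

/-- Explosive variance in the Harvey–Fernandes model: if `q ∈ (0,1)`, `0 < λ_t ≤ M`,
`β_{t+1} = q·β_t + λ_{t+1}` with `β₁ > 0`, and `v_{t+1} = v_t + (1/q − 1)·(1/β_t)`,
then `v_t → ∞`. -/
theorem stmt_13 (q M : ℝ) (hq : q ∈ Set.Ioo (0 : ℝ) 1) (hM : 0 < M)
    (lam β v : ℕ → ℝ)
    (hlam : ∀ t ≥ 1, 0 < lam t ∧ lam t ≤ M)
    (hβ1 : 0 < β 1)
    (hrecβ : ∀ t ≥ 1, β (t + 1) = q * β t + lam (t + 1))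
    (hrecv : ∀ t ≥ 1, v (t + 1) = v t + (1 / q - 1) * (1 / β t)) :
    Filter.Tendsto v Filter.atTop Filter.atTop := by
  obtain ⟨hq0, hq1⟩ := hq
  have h1q : 0 < 1 - q := sub_pos.2 hq1
  set C := max (β 1) (M / (1 - q))
  have hC0 : 0 < C := hβ1.trans_le (le_max_left _ _)
  have hMC : M ≤ C * (1 - q) := (div_le_iff₀ h1q).1 (le_max_right _ _)
  have hβ : ∀ t ≥ 1, 0 < β t ∧ β t ≤ C := by
    intro t ht
    induction t, ht using Nat.le_induction with
    | base => exact ⟨hβ1, le_max_left _ _⟩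
    | succ t ht ih =>
      obtain ⟨hl0, hlM⟩ := hlam (t + 1) (Nat.le_add_left _ _)
      rw [hrecβ t ht]
      exact ⟨add_pos (mul_pos hq0 ih.1) hl0,
        by linarith [mul_le_mul_of_nonneg_left ih.2 hq0.le]⟩
  have hgain : 0 < 1 / q - 1 := sub_pos.2 (one_lt_one_div hq0 hq1)
  refine tendsto_atTop_of_add_const_le (n₀ := 1) (mul_pos hgain (one_div_pos.2 hC0)) ?_
  intro t ht
  rw [hrecv t ht]
  gcongr
  · exact (hβ t ht).1
  · exact (hβ t ht).2
end

section
/- Variance convergence to zero in the model with decreasing variance (deterministic core of Lemma 5): let p ∈ [0,1) and m > 0, let (λ_t)_{t≥1} be a real sequence with λ_t ≥ m for all t, let β_1 > 0 and β_{t+1} = β_t + λ_{t+1} for t ≥ 1, and let (w_t)_{t≥1} and (v_t)_{t≥1} be real sequences with w_t ≥ 0, v_t = 1/β_t + w_t, and v_{t+1} = v_t + (p² − 1)·w_t for all t ≥ 1. Then v_t → 0 as t → ∞. -/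
/-- Variance convergence to zero in the model with decreasing variance: if `p ∈ [0,1)`,
`λ_t ≥ m > 0`, `β_{t+1} = β_t + λ_{t+1}` with `β₁ > 0`, `w_t ≥ 0`, `v_t = 1/β_t + w_t`, and
`v_{t+1} = v_t + (p² − 1)·w_t`, then `v_t → 0`. -/
theorem stmt_14 (p m : ℝ) (hp : p ∈ Set.Ico (0 : ℝ) 1) (hm : 0 < m)
    (lam β w v : ℕ → ℝ)
    (hlam : ∀ t ≥ 1, m ≤ lam t)
    (hβ1 : 0 < β 1)
    (hrecβ : ∀ t ≥ 1, β (t + 1) = β t + lam (t + 1))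
    (hw : ∀ t ≥ 1, 0 ≤ w t)
    (hv : ∀ t ≥ 1, v t = 1 / β t + w t)
    (hrecv : ∀ t ≥ 1, v (t + 1) = v t + (p ^ 2 - 1) * w t) :
    Filter.Tendsto v Filter.atTop (nhds 0) := by
  have hq : 0 < 1 - p ^ 2 := by nlinarith [hp.1, hp.2]
  have hβ : ∀ n : ℕ, β 1 + n * m ≤ β (n + 1) := by
    intro n
    induction n with
    | zero => simp
    | succ k ih =>
      have h1 := hrecβ (k + 1) (by omega)
      have h2 := hlam (k + 1 + 1) (by omega)
      push_cast
      linarith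
  have hβpos : ∀ n : ℕ, 0 < β (n + 1) := fun n =>
    (by positivity : 0 < β 1 + n * m).trans_le (hβ n)
  have hβtop : Filter.Tendsto (fun n : ℕ => β (n + 1)) Filter.atTop Filter.atTop :=
    Filter.tendsto_atTop_mono hβ
      (Filter.tendsto_atTop_add_const_left _ _ (tendsto_natCast_atTop_atTop.atTop_mul_const hm))
  have hanti : Antitone fun n : ℕ => v (n + 1) := by
    refine antitone_nat_of_succ_le fun n => ?_
    have h1 := hrecv (n + 1) (by omega)
    have h2 := mul_nonneg hq.le (hw (n + 1) (by omega))
    linarith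
  have hnonneg : ∀ n : ℕ, 0 ≤ v (n + 1) := by
    intro n
    rw [hv (n + 1) (by omega)]
    exact add_nonneg (one_div_pos.2 (hβpos n)).le (hw (n + 1) (by omega))
  have hlim := tendsto_atTop_ciInf hanti ⟨0, Set.forall_mem_range.2 hnonneg⟩
  have hwlim : Filter.Tendsto (fun n : ℕ => w (n + 1)) Filter.atTop (nhds 0) := by
    have h := (hlim.sub (hlim.comp (Filter.tendsto_add_atTop_nat 1))).div_const (1 - p ^ 2)
    rw [sub_self, zero_div] at h
    refine h.congr fun n => ?_
    have h1 := hrecv (n + 1) (by omega)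
    simp only [Function.comp_apply]
    rw [div_eq_iff hq.ne', h1]
    ring
  rw [← Filter.tendsto_add_atTop_iff_nat 1]
  have h := hβtop.inv_tendsto_atTop.add hwlim
  rw [add_zero] at h
  refine h.congr fun n => ?_
  simp [hv (n + 1) (by omega)]
end
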